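/- (Increasing-tree formula, from the proof of Theorem 6.2.) Let n ≥ 1 and let a_2,…,a_n be positive integers. Let G be the loopless multigraph on vertex set [n] = {1,…,n} in which, for i < j, the vertices i and j are joined by exactly a_j parallel edges (i.e. e_{i,j}(G) = a_{max(i,j)}). Then, as polynomials in q, Σ_{S ⊆ E with ([n],S) connected} (q−1)^{#S} = (q−1)^{n−1} · Σ_T Π_{i=2}^{n} [Σ_{j ∈ desc_T(i) ∪ {i}} a_j]_q, where T ranges over all increasing spanning trees on [n] rooted at 1 (trees in which every non-root vertex is larger than its parent) and desc_T(i) denotes the set of descendants of i in T. -/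

import Mathlib

open Finset

open scoped Classical

noncomputable section

/-! ### Set partitions -/

/-- `π` is a set partition of the finite set `H`. -/
def IsSetPartition {α : Type*} (π : Finset (Finset α)) (H : Finset α) : Prop :=
  (∀ B ∈ π, B ⊆ H) ∧ (∀ B ∈ π, B.Nonempty) ∧
    (∀ B ∈ π, ∀ C ∈ π, B ≠ C → Disjoint B C) ∧ (∀ a ∈ H, ∃ B ∈ π, a ∈ B)

/-- The finite set of all set partitions of `H`. -/
def setPartitions {α : Type*} (H : Finset α) : Finset (Finset (Finset α)) :=
  H.powerset.powerset.filter (fun π => IsSetPartition π H)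

/-- The joint cumulant of the family `u` on the subset `H`. -/
def jointCumulant {A : Type*} [CommRing A] {ι : Type*} (u : Finset ι → A) (H : Finset ι) : A :=
  ∑ π ∈ setPartitions H,
    (-1 : A) ^ (π.card - 1) * ((π.card - 1).factorial : A) * ∏ B ∈ π, u B

/-! ### Multigraphs -/

/-- Number of edges of the multigraph with endpoint map `ends` whose endpoint set is `{i,j}`. -/
def eCnt {V E : Type*} [Fintype E] (ends : E → Sym2 V) (i j : V) : ℕ :=
  (univ.filter fun e => ends e = s(i, j)).card

/-- The spanning subgraph `(V, S)` is connected. -/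
def SConnected {V E : Type*} (ends : E → Sym2 V) (S : Finset E) : Prop :=
  ∀ v w : V, Relation.ReflTransGen (fun a b => ∃ e ∈ S, ends e = s(a, b)) v w

/-- The subgraph `(B, S)` is connected. -/
def SConnectedOn {V E : Type*} (ends : E → Sym2 V) (B : Finset V) (S : Finset E) : Prop :=
  ∀ v ∈ B, ∀ w ∈ B, Relation.ReflTransGen (fun a b => ∃ e ∈ S, ends e = s(a, b)) v w

/-- `E|_B`: the edges with both endpoints in `B`. -/
def edgesIn {V E : Type*} [Fintype E] (ends : E → Sym2 V) (B : Finset V) : Finset E :=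
  univ.filter fun e => ∀ v ∈ ends e, v ∈ B

/-- `c_{G|_B}(q) = Σ_{S ⊆ E|_B, (B,S) connected} q^{#S}` as a polynomial in `q`. -/
def connPoly {V E : Type*} [Fintype E] (ends : E → Sym2 V) (B : Finset V) : Polynomial ℤ :=
  ∑ S ∈ (edgesIn ends B).powerset.filter (fun S => SConnectedOn ends B S),
    Polynomial.X ^ S.card

/-- Number of edges joining `w` to some vertex of `B`. -/
def dCnt {V E : Type*} [Fintype E] (ends : E → Sym2 V) (B : Finset V) (w : V) : ℕ :=
  (univ.filter fun e => ∃ b ∈ B, ends e = s(w, b)).card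

/-! ### The `G`-inversion polynomial -/

/-- `[m]_q = 1 + q + ⋯ + q^{m-1}`. -/
def nq {R : Type*} [CommSemiring R] (q : R) (m : ℕ) : R := ∑ k ∈ Finset.range m, q ^ k

/-- Rooted spanning trees (encoded by parent maps, rooted at `0`) of the simple graph `G̃`
underlying the multigraph on `Fin (r+1)` with edge multiplicities `e`. -/
def parentMaps {r : ℕ} (e : Fin (r+1) → Fin (r+1) → ℕ) : Finset (Fin (r+1) → Fin (r+1)) :=
  univ.filter fun p => p 0 = 0 ∧ (∀ w, w ≠ 0 → p w ≠ w ∧ 0 < e w (p w)) ∧ ∀ w, ∃ k, p^[k] w = 0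

/-- `(i,j)` is a `κ`-inversion of the spanning tree encoded by `p`. -/
def isKappaInv {r : ℕ} (e : Fin (r+1) → Fin (r+1) → ℕ) (p : Fin (r+1) → Fin (r+1))
    (i j : Fin (r+1)) : Prop :=
  i ≠ 0 ∧ j ≠ 0 ∧ i ≠ j ∧ (∃ k, p^[k] j = i) ∧ j < i ∧ p i ≠ j ∧ 0 < e j (p i)

/-- `κ(T) = Σ_{(i,j) κ-inversion} e_{parent(i), j}`. -/
def kappaStat {r : ℕ} (e : Fin (r+1) → Fin (r+1) → ℕ) (p : Fin (r+1) → Fin (r+1)) : ℕ :=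
  ∑ pr ∈ (univ ×ˢ univ : Finset (Fin (r+1) × Fin (r+1))).filter
    (fun pr => isKappaInv e p pr.1 pr.2), e (p pr.1) pr.2

/-- `δ_T(w) = Σ_u e_{u, parent(w)}`, `u` ranging over descendants of `w` together with `w`. -/
def deltaStat {r : ℕ} (e : Fin (r+1) → Fin (r+1) → ℕ) (p : Fin (r+1) → Fin (r+1))
    (w : Fin (r+1)) : ℕ :=
  ∑ u ∈ univ.filter (fun u => ∃ k, p^[k] u = w), e u (p w)

/-- The `G`-inversion polynomial `𝓘_G(q)` of the multigraph on `Fin (r+1)` with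
edge multiplicities `e`, evaluated at an element `q` of a commutative (semi)ring. -/
def Iinv {r : ℕ} {R : Type*} [CommSemiring R] (e : Fin (r+1) → Fin (r+1) → ℕ) (q : R) : R :=
  q ^ (∑ i, e i i) *
    ∑ p ∈ parentMaps e, q ^ kappaStat e p * ∏ w ∈ univ.erase (0 : Fin (r+1)), nq q (e w (p w))

/-! ### Partitions, Young diagrams and fillings -/

/-- `f : ℕ → ℕ` encodes a partition: `f j` is the `j`-th part (for `j ≥ 1`). -/
def IsPartitionFun (f : ℕ → ℕ) : Prop := Antitone f ∧ ∃ N, f N = 0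

/-- The number of (nonempty) rows of the diagram of `f`. -/
def nRows (f : ℕ → ℕ) : ℕ := sSup {j | f j ≠ 0}

/-- `λ^t_i`: the length of the `i`-th column of the diagram of `f`. -/
def colLen (f : ℕ → ℕ) (i : ℕ) : ℕ :=
  ((Finset.Icc 1 (nRows f)).filter (fun j => i ≤ f j)).card

/-- The cells `(i,j)`, `1 ≤ i ≤ f j`, `j ≥ 1`, of the Young diagram of `f`
(French convention, `i` the column index and `j` the row index). -/
def cells (f : ℕ → ℕ) : Finset (ℕ × ℕ) :=
  (Finset.Icc 1 (f 1) ×ˢ Finset.Icc 1 (nRows f)).filter (fun c => c.1 ≤ f c.2)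

/-- Fillings of the diagram of `f` with entries in `{1, …, N}`, encoded as functions
`ℕ × ℕ → ℕ` vanishing outside the diagram. -/
def fillings (f : ℕ → ℕ) (N : ℕ) : Finset ((ℕ × ℕ) → ℕ) :=
  ((cells f).pi (fun _ => Finset.Icc 1 N)).image
    (fun g c => if h : c ∈ cells f then g c h else 0)

/-- The descent set of a filling. -/
def desSet (f : ℕ → ℕ) (σ : (ℕ × ℕ) → ℕ) : Finset (ℕ × ℕ) :=
  (cells f).filter (fun c => 2 ≤ c.2 ∧ σ (c.1, c.2 - 1) < σ c)

/-- `maj(σ) = Σ_{□ ∈ Des(σ)} (leg(□) + 1)`. -/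
def majStat (f : ℕ → ℕ) (σ : (ℕ × ℕ) → ℕ) : ℕ :=
  ∑ c ∈ desSet f σ, (colLen f c.1 - c.2 + 1)

/-- The counterclockwise-increasing condition defining inversion pairs; the box below `c1`
is read via `σ`, which vanishes off the diagram (giving the convention `σ(□_3) = 0`). -/
def invTriple (σ : (ℕ × ℕ) → ℕ) (c1 c2 : ℕ × ℕ) : Prop :=
  (σ c1 ≤ σ (c1.1, c1.2 - 1) ∧ σ (c1.1, c1.2 - 1) < σ c2) ∨
  (σ (c1.1, c1.2 - 1) < σ c2 ∧ σ c2 < σ c1) ∨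
  (σ c2 < σ c1 ∧ σ c1 ≤ σ (c1.1, c1.2 - 1))

/-- The set of inversion pairs of a filling. -/
def invPairs (f : ℕ → ℕ) (σ : (ℕ × ℕ) → ℕ) : Finset ((ℕ × ℕ) × (ℕ × ℕ)) :=
  ((cells f) ×ˢ (cells f)).filter
    (fun pr => pr.1.2 = pr.2.2 ∧ pr.1.1 < pr.2.1 ∧ invTriple σ pr.1 pr.2)

/-- `inv(σ)`: the number of inversion pairs. -/
def invStat (f : ℕ → ℕ) (σ : (ℕ × ℕ) → ℕ) : ℕ := (invPairs f σ).card

/-! ### The ring `ℤ[q, t, x₁, x₂, …]` and Macdonald polynomials -/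

/-- The polynomial ring `ℤ[q, t, x₀, x₁, x₂, …]`. -/
abbrev MR : Type := MvPolynomial (Fin 2 ⊕ ℕ) ℤ

/-- The variable `q`. -/
def qv : MR := MvPolynomial.X (Sum.inl 0)

/-- The variable `t`. -/
def tv : MR := MvPolynomial.X (Sum.inl 1)

/-- The variable `x_k`. -/
def xv (k : ℕ) : MR := MvPolynomial.X (Sum.inr k)

/-- Haglund's formula: the modified Macdonald polynomial in the variables `x_1, …, x_N`. -/
def macH (f : ℕ → ℕ) (N : ℕ) : MR :=
  ∑ σ ∈ fillings f N, qv ^ invStat f σ * tv ^ majStat f σ * ∏ c ∈ cells f, xv (σ c)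

/-- `λ^B = ⊕_{b ∈ B} λ^b`. -/
def lamB {r : ℕ} (lam : Fin (r+1) → ℕ → ℕ) (B : Finset (Fin (r+1))) : ℕ → ℕ :=
  fun j => ∑ b ∈ B, lam b j

/-- The (unnormalized) Macdonald cumulant
`Σ_{π ∈ 𝒫([r])} (-1)^{#π-1} (#π-1)! Π_{B ∈ π} H̃_{λ^B}`. -/
def macCumulant {r : ℕ} (lam : Fin (r+1) → ℕ → ℕ) (N : ℕ) : MR :=
  ∑ π ∈ setPartitions (univ : Finset (Fin (r+1))),
    (-1 : MR) ^ (π.card - 1) * ((π.card - 1).factorial : MR) * ∏ B ∈ π, macH (lamB lam B) N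

/-! ### Coloring of the diagram `λ^B` -/

/-- Labels `(b, i)`, `b ∈ B`, `1 ≤ i ≤ λ^b_1`, of the columns of the diagrams `λ^b`, `b ∈ B`. -/
def columnPairs {r : ℕ} (lam : Fin (r+1) → ℕ → ℕ) (B : Finset (Fin (r+1))) :
    Finset (Fin (r+1) × ℕ) :=
  (B ×ˢ Finset.Icc 1 (lamB lam B 1)).filter (fun p => p.2 ≤ lam p.1 1)

/-- The column `p'` comes weakly before the column `p` in the sorted order
(longer first; ties first by color, then by column index). -/
def colBefore {r : ℕ} (lam : Fin (r+1) → ℕ → ℕ) (p' p : Fin (r+1) × ℕ) : Prop :=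
  colLen (lam p.1) p.2 < colLen (lam p'.1) p'.2 ∨
    (colLen (lam p'.1) p'.2 = colLen (lam p.1) p.2 ∧
      (p'.1 < p.1 ∨ (p'.1 = p.1 ∧ p'.2 ≤ p.2)))

/-- The position in `λ^B` of the column `i` of `λ^b`. -/
def posIn {r : ℕ} (lam : Fin (r+1) → ℕ → ℕ) (B : Finset (Fin (r+1)))
    (b : Fin (r+1)) (i : ℕ) : ℕ :=
  ((columnPairs lam B).filter (fun p' => colBefore lam p' (b, i))).card

/-- The label `(b, i)` of the column of `λ^B` at position `c`. -/
def colAt {r : ℕ} (lam : Fin (r+1) → ℕ → ℕ) (B : Finset (Fin (r+1))) (c : ℕ) :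
    Fin (r+1) × ℕ :=
  if h : ∃ p ∈ columnPairs lam B, posIn lam B p.1 p.2 = c then h.choose else (0, 1)

/-- The filling `σ^B` of `λ^B` induced from a filling `σ` of `λ^{[r]}` via the
identification of boxes given by the coloring. -/
def inducedFilling {r : ℕ} (lam : Fin (r+1) → ℕ → ℕ) (B : Finset (Fin (r+1)))
    (σ : (ℕ × ℕ) → ℕ) : (ℕ × ℕ) → ℕ :=
  fun cj =>
    if ∃ p ∈ columnPairs lam B, posIn lam B p.1 p.2 = cj.1 then
      σ (posIn lam univ (colAt lam B cj.1).1 (colAt lam B cj.1).2, cj.2)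
    else 0

/-- The color of the column `x` of `λ^{[r]}`. -/
def colColor {r : ℕ} (lam : Fin (r+1) → ℕ → ℕ) (x : ℕ) : Fin (r+1) :=
  (colAt lam univ x).1

/-- Edge multiplicities of the multigraph `G^σ`: the number of inversion pairs of `σ`
colored by `{i, j}`. -/
def eG {r : ℕ} (lam : Fin (r+1) → ℕ → ℕ) (σ : (ℕ × ℕ) → ℕ) (i j : Fin (r+1)) : ℕ :=
  ((invPairs (lamB lam univ) σ).filter (fun pr =>
    (colColor lam pr.1.1 = i ∧ colColor lam pr.2.1 = j) ∨
    (colColor lam pr.1.1 = j ∧ colColor lam pr.2.1 = i))).card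

/-- Edge multiplicities of the multigraph `G^{□_1,…,□_s}` attached to a set `D` of boxes:
for each box of `D` and each box strictly to its left in the same row, one edge joining
the colors of the two columns. -/
def eBox {r : ℕ} (lam : Fin (r+1) → ℕ → ℕ) (D : Finset (ℕ × ℕ)) (i j : Fin (r+1)) : ℕ :=
  ((D ×ˢ cells (lamB lam univ)).filter (fun pr =>
    pr.2.2 = pr.1.2 ∧ pr.2.1 < pr.1.1 ∧
      ((colColor lam pr.2.1 = i ∧ colColor lam pr.1.1 = j) ∨
       (colColor lam pr.2.1 = j ∧ colColor lam pr.1.1 = i)))).card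


/-- The edge type of the loopless multigraph on `[n+1]` in which `i < j` are joined by
`a j` parallel edges. -/
abbrev a15Edges (n : ℕ) (a : Fin (n+1) → ℕ) : Type :=
  Σ p : Fin (n+1) × Fin (n+1), Fin (if p.1 < p.2 then a p.2 else 0)

/-- Endpoint map of the above multigraph. -/
def a15ends (n : ℕ) (a : Fin (n+1) → ℕ) : a15Edges n a → Sym2 (Fin (n+1)) :=
  fun e => s(e.1.1, e.1.2)

/-! ### Increasing parent maps -/

/-- `p` is the parent map of an increasing tree on `Fin (n+1)` rooted at `0`. -/
def IsIncreasing {n : ℕ} (p : Fin (n+1) → Fin (n+1)) : Prop :=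
  p 0 = 0 ∧ ∀ w, w ≠ 0 → p w < w

/-- `u` equals `w` or is a descendant of `w` for the parent map `p`. -/
def Below {α : Type*} (p : α → α) (u w : α) : Prop := ∃ k, p^[k] u = w

namespace Below

variable {α : Type*} {p : α → α} {u v w : α}

theorem refl (p : α → α) (u : α) : Below p u u := ⟨0, rfl⟩

theorem parent (p : α → α) (u : α) : Below p u (p u) := ⟨1, rfl⟩

theorem trans (h₁ : Below p u v) (h₂ : Below p v w) : Below p u w := by
  obtain ⟨k, rfl⟩ := h₁
  obtain ⟨l, rfl⟩ := h₂
  exact ⟨l + k, Function.iterate_add_apply p l k u⟩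

/-- Two ancestors of the same vertex are comparable. -/
theorem comparable (h₁ : Below p u v) (h₂ : Below p u w) : Below p v w ∨ Below p w v := by
  obtain ⟨k, rfl⟩ := h₁
  obtain ⟨l, rfl⟩ := h₂
  rcases le_total k l with h | h
  · exact .inl ⟨l - k, by rw [← Function.iterate_add_apply, Nat.sub_add_cancel h]⟩
  · exact .inr ⟨k - l, by rw [← Function.iterate_add_apply, Nat.sub_add_cancel h]⟩

theorem eq_or_parent (h : Below p u w) : u = w ∨ Below p (p u) w := by
  obtain ⟨k, rfl⟩ := h
  cases k with
  | zero => exact .inl rfl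
  | succ k => exact .inr ⟨k, rfl⟩

end Below

namespace IsIncreasing

variable {n : ℕ} {p : Fin (n+1) → Fin (n+1)} {u v w : Fin (n+1)}

theorem parent_le (hp : IsIncreasing p) (w : Fin (n+1)) : p w ≤ w := by
  by_cases h : w = 0
  · rw [h, hp.1]
  · exact (hp.2 w h).le

theorem le_of_below (hp : IsIncreasing p) (h : Below p u w) : w ≤ u := by
  obtain ⟨k, rfl⟩ := h
  induction k generalizing u with
  | zero => exact le_rfl
  | succ k ih => exact ih.trans (hp.parent_le u)

theorem le_parent_of_below (hp : IsIncreasing p) (h : Below p u w) (hne : w ≠ u) : w ≤ p u := by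
  rcases h.eq_or_parent with h | h
  · exact absurd h.symm hne
  · exact hp.le_of_below h

theorem below_zero (hp : IsIncreasing p) (u : Fin (n+1)) : Below p u 0 := by
  induction u using WellFoundedLT.induction with
  | ind u ih =>
    by_cases h : u = 0
    · exact h ▸ Below.refl p u
    · exact (Below.parent p u).trans (ih _ (hp.2 u h))

/-- A proper descendant of `w` lies below some child of `w`. -/
theorem exists_child (hp : IsIncreasing p) (h : Below p u w) (hne : w ≠ u) :
    ∃ c, c ≠ 0 ∧ p c = w ∧ Below p u c := by
  induction u using WellFoundedLT.induction with
  | ind u ih =>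
    have hu : u ≠ 0 := by
      rintro rfl
      exact hne (le_antisymm (hp.le_of_below h) (Fin.zero_le w))
    by_cases hw : w = p u
    · exact ⟨u, hu, hw.symm, Below.refl p u⟩
    · rcases h.eq_or_parent with h | h
      · exact absurd h.symm hne
      · obtain ⟨c, hc, hcw, hb⟩ := ih _ (hp.2 u hu) h hw
        exact ⟨c, hc, hcw, (Below.parent p u).trans hb⟩

/-- Siblings with a common descendant coincide. -/
theorem eq_of_below_of_parent_eq (hp : IsIncreasing p) (hv : v ≠ 0) (hw : w ≠ 0)
    (huv : Below p u v) (huw : Below p u w) (h : p v = p w) : v = w := by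
  by_contra hne
  rcases huv.comparable huw with hb | hb
  · exact absurd (hp.le_parent_of_below hb (Ne.symm hne)) (h ▸ (hp.2 w hw).not_ge)
  · exact absurd (hp.le_parent_of_below hb hne) (h ▸ (hp.2 v hv).not_ge)

end IsIncreasing

/-! ### Connections through large vertices -/

section Adapted

variable {n : ℕ} {a : Fin (n+1) → ℕ} {S : Finset (a15Edges n a)}

theorem a15Edges.fst_lt_snd (e : a15Edges n a) : e.1.1 < e.1.2 := by
  by_contra h
  have := e.2.isLt
  simp [h] at this

/-- `u` and `v` are joined by a path of edges of `S` all of whose endpoints are at least `t`. -/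
def ConnFrom (S : Finset (a15Edges n a)) (t u v : Fin (n+1)) : Prop :=
  Relation.ReflTransGen (fun x y => ∃ e ∈ S, t ≤ e.1.1 ∧ a15ends n a e = s(x, y)) u v

namespace ConnFrom

variable {t t' u v w : Fin (n+1)}

theorem mono (h : ConnFrom S t u v) (ht : t' ≤ t) : ConnFrom S t' u v :=
  Relation.ReflTransGen.mono (fun _ _ ⟨e, he, hte, hx⟩ => ⟨e, he, ht.trans hte, hx⟩) _ _ h

theorem symm (h : ConnFrom S t u v) : ConnFrom S t v u :=
  Relation.ReflTransGen.mono
    (fun _ _ ⟨e, he, hte, hx⟩ => ⟨e, he, hte, hx.trans Sym2.eq_swap⟩) _ _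
    (Relation.ReflTransGen.swap _ _ h)

theorem trans (h₁ : ConnFrom S t u v) (h₂ : ConnFrom S t v w) : ConnFrom S t u w :=
  Relation.ReflTransGen.trans h₁ h₂

theorem edge {e : a15Edges n a} (he : e ∈ S) (ht : t ≤ e.1.1) : ConnFrom S t e.1.1 e.1.2 :=
  Relation.ReflTransGen.single ⟨e, he, ht, rfl⟩

theorem le (h : ConnFrom S t u v) (hu : t ≤ u) : t ≤ v := by
  induction h with
  | refl => exact hu
  | tail _ hs _ =>
    obtain ⟨e, -, ht, he⟩ := hs
    have := e.fst_lt_snd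
    rcases Sym2.eq_iff.1 he with ⟨-, rfl⟩ | ⟨rfl, -⟩
    · exact ht.trans this.le
    · exact ht

theorem sConnected_iff : SConnected (a15ends n a) S ↔ ∀ v, ConnFrom S 0 v 0 := by
  have key : ∀ v w, Relation.ReflTransGen (fun x y => ∃ e ∈ S, a15ends n a e = s(x, y)) v w ↔
      ConnFrom S 0 v w := fun v w => by simp [ConnFrom]
  constructor
  · exact fun h v => (key v 0).1 (h v 0)
  · exact fun h v w => (key v w).2 ((h v).trans (h w).symm)

end ConnFrom

/-- The edges joining the parent of `w` to `w` or one of its descendants. -/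
def subtreeEdges (a : Fin (n+1) → ℕ) (p : Fin (n+1) → Fin (n+1)) (w : Fin (n+1)) :
    Finset (a15Edges n a) :=
  univ.filter fun e => e.1.1 = p w ∧ Below p e.1.2 w

theorem card_subtreeEdges {p : Fin (n+1) → Fin (n+1)} (hp : IsIncreasing p) {w : Fin (n+1)}
    (hw : w ≠ 0) :
    (subtreeEdges a p w).card = ∑ u ∈ univ.filter (fun u => ∃ k, p^[k] u = w), a u := by
  have h : subtreeEdges a p w =
      (({p w} : Finset (Fin (n+1))) ×ˢ univ.filter (fun u => Below p u w)).sigma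
        (fun _ => univ) := by
    ext e
    simp only [subtreeEdges, mem_filter, mem_univ, true_and, mem_sigma, mem_product,
      mem_singleton, and_true]
  rw [h, card_sigma, sum_product, sum_singleton]
  refine sum_congr rfl fun u hu => ?_
  have hwu : w ≤ u := hp.le_of_below (mem_filter.1 hu).2
  simp [(hp.2 w hw).trans_le hwu]

/-- `p` is the elimination tree of `S`: every edge of `S` joins a vertex to one of its
descendants, and the parent of `w` is joined to the subtree at `w` by an edge of `S`. -/
structure Adapted (p : Fin (n+1) → Fin (n+1)) (S : Finset (a15Edges n a)) : Prop where
  below : ∀ e ∈ S, Below p e.1.2 e.1.1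
  nonempty : ∀ w, w ≠ 0 → (S ∩ subtreeEdges a p w).Nonempty

variable {p p' : Fin (n+1) → Fin (n+1)} {t u v w : Fin (n+1)}

theorem Adapted.connFrom_of_below (hp : IsIncreasing p) (h : Adapted p S) (hb : Below p u w) :
    ConnFrom S w w u := by
  induction w using WellFoundedGT.induction generalizing u with
  | ind w ih =>
    by_cases hne : w = u
    · exact hne ▸ Relation.ReflTransGen.refl
    obtain ⟨c, hc, rfl, hcu⟩ := hp.exists_child hb hne
    have hlt := hp.2 c hc
    obtain ⟨e, he⟩ := h.nonempty c hc
    simp only [subtreeEdges, mem_inter, mem_filter, mem_univ, true_and] at he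
    obtain ⟨heS, hep, hec⟩ := he
    have h1 : ConnFrom S (p c) (p c) e.1.2 := by
      have := ConnFrom.edge heS hep.ge
      rwa [hep] at this
    exact h1.trans (((ih c hlt hec).symm.trans (ih c hlt hcu)).mono hlt.le)

theorem below_of_connFrom (hp : IsIncreasing p) (h : ∀ e ∈ S, Below p e.1.2 e.1.1)
    (hc : ConnFrom S t t u) : Below p u t := by
  induction hc with
  | refl => exact Below.refl p t
  | tail _ hs ih =>
    obtain ⟨e, heS, ht, he⟩ := hs
    have hb := h e heS
    rcases Sym2.eq_iff.1 he with ⟨rfl, rfl⟩ | ⟨rfl, rfl⟩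
    · exact hb.trans ih
    · rcases hb.comparable ih with h' | h'
      · exact h'
      · rw [le_antisymm (hp.le_of_below h') ht]
        exact Below.refl p _

theorem Adapted.sConnected (hp : IsIncreasing p) (h : Adapted p S) :
    SConnected (a15ends n a) S :=
  ConnFrom.sConnected_iff.2 fun v => (h.connFrom_of_below hp (hp.below_zero v)).symm

theorem Adapted.parent_le (hp : IsIncreasing p) (hp' : IsIncreasing p') (h : Adapted p S)
    (h' : Adapted p' S) (w : Fin (n+1)) : p w ≤ p' w := by
  by_cases hw : w = 0
  · rw [hw, hp.1, hp'.1]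
  · exact hp'.le_parent_of_below
      (below_of_connFrom hp' h'.below (h.connFrom_of_below hp (Below.parent p w))) (hp.2 w hw).ne

theorem Adapted.unique (hp : IsIncreasing p) (hp' : IsIncreasing p') (h : Adapted p S)
    (h' : Adapted p' S) : p = p' :=
  funext fun w => le_antisymm (h.parent_le hp hp' h' w) (h'.parent_le hp' hp h w)

theorem exists_adapted (hS : SConnected (a15ends n a) S) :
    ∃ p, IsIncreasing p ∧ Adapted p S := by
  rw [ConnFrom.sConnected_iff] at hS
  have hex : ∀ w : Fin (n+1), ∃ t, (w = 0 → t = 0) ∧ (w ≠ 0 → t < w) ∧ ConnFrom S t w t ∧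
      ∀ t' < w, ConnFrom S t' w t' → t' ≤ t := by
    intro w
    by_cases hw : w = 0
    · subst hw
      exact ⟨0, fun _ => rfl, fun h => absurd rfl h, Relation.ReflTransGen.refl,
        fun t' ht' => absurd ht' (Fin.not_lt_zero t')⟩
    · have hne : (univ.filter fun t => t < w ∧ ConnFrom S t w t).Nonempty :=
        ⟨0, by simp [hS w, Fin.pos_iff_ne_zero.2 hw]⟩
      obtain ⟨t, ht, hmax⟩ := exists_max_image _ id hne
      simp only [mem_filter, mem_univ, true_and, id, and_imp] at ht hmax
      exact ⟨t, fun h => absurd h hw, fun _ => ht.1, ht.2, hmax⟩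
  choose p h0 hlt hconn hmax using hex
  have hp : IsIncreasing p := ⟨h0 0 rfl, hlt⟩
  have hbelow : ∀ w u, ConnFrom S w w u → Below p u w := by
    intro w u
    induction u using WellFoundedLT.induction with
    | ind u ih =>
      intro hc
      rcases (hc.le le_rfl).eq_or_lt with rfl | hwu
      · exact Below.refl p _
      · have hle := hmax u w hwu hc.symm
        have hu : u ≠ 0 := ((Fin.zero_le w).trans_lt hwu).ne'
        exact (Below.parent p u).trans (ih _ (hlt u hu) (hc.trans ((hconn u).mono hle)))
  have hedge : ∀ e ∈ S, Below p e.1.2 e.1.1 := fun e he => hbelow _ _ (ConnFrom.edge he le_rfl)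
  refine ⟨p, hp, hedge, fun w hw => ?_⟩
  by_contra hemp
  have key : ∀ v, ConnFrom S (p w) w v → Below p v w := by
    intro v hv
    induction hv with
    | refl => exact Below.refl p w
    | tail _ hs ih =>
      obtain ⟨e, heS, ht, he⟩ := hs
      have hb := hedge e heS
      rcases Sym2.eq_iff.1 he with ⟨rfl, rfl⟩ | ⟨rfl, rfl⟩
      · exact hb.trans ih
      · rcases hb.comparable ih with h | h
        · exact h
        · by_cases hne : e.1.1 = w
          · rw [hne]; exact Below.refl p w
          · refine absurd ⟨e, ?_⟩ hemp
            have := le_antisymm (hp.le_parent_of_below h hne) ht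
            simp only [subtreeEdges, mem_inter, mem_filter, mem_univ, true_and]
            exact ⟨heS, this, ih⟩
  exact (hlt w hw).not_ge (hp.le_of_below (key _ (hconn w)))

theorem pairwiseDisjoint_subtreeEdges (hp : IsIncreasing p) :
    ((univ.erase (0 : Fin (n+1)) : Finset _) : Set (Fin (n+1))).PairwiseDisjoint
      (subtreeEdges a p) := by
  intro v hv w hw hne
  refine disjoint_left.2 fun e h₁ h₂ => hne ?_
  simp only [subtreeEdges, mem_filter, mem_univ, true_and] at h₁ h₂
  exact hp.eq_of_below_of_parent_eq (by simpa using hv) (by simpa using hw) h₁.2 h₂.2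
    (h₁.1.symm.trans h₂.1)

theorem adapted_iff (hp : IsIncreasing p) : Adapted p S ↔
    S ⊆ (univ.erase (0 : Fin (n+1))).biUnion (subtreeEdges a p) ∧
      ∀ w ∈ univ.erase (0 : Fin (n+1)), (S ∩ subtreeEdges a p w).Nonempty := by
  constructor
  · refine fun h => ⟨fun e he => ?_, fun w hw => h.nonempty w (by simpa using hw)⟩
    obtain ⟨c, hc, hce, hb⟩ := hp.exists_child (h.below e he) e.fst_lt_snd.ne
    simp only [mem_biUnion, mem_erase, subtreeEdges, mem_filter, mem_univ, true_and, and_true]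
    exact ⟨c, hc, hce.symm, hb⟩
  · refine fun h => ⟨fun e he => ?_, fun w hw => h.2 w (by simpa using hw)⟩
    obtain ⟨c, -, hc⟩ := mem_biUnion.1 (h.1 he)
    simp only [subtreeEdges, mem_filter, mem_univ, true_and] at hc
    rw [hc.1]
    exact hc.2.trans (Below.parent p c)

end Adapted

/-! ### Generating functions -/

theorem sum_pow_card_powerset_nonempty {R β : Type*} [CommRing R] (x : R) (s : Finset β) :
    ∑ T ∈ s.powerset.filter (fun T => T.Nonempty), x ^ T.card = (x + 1) ^ s.card - 1 := by
  have h : s.powerset.filter (fun T => T.Nonempty) = s.powerset.erase ∅ := by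
    ext T
    simp [nonempty_iff_ne_empty, and_comm]
  rw [h, eq_sub_iff_add_eq, ← sum_pow_mul_eq_add_pow]
  simp

/-- Subsets of a disjoint union meeting every part are counted by a product. -/
theorem sum_pow_card_powerset_biUnion {R ι β : Type*} [CommRing R] [DecidableEq ι] [DecidableEq β] (x : R)
    (I : Finset ι)
    (E : ι → Finset β) (hE : (I : Set ι).PairwiseDisjoint E) :
    ∑ S ∈ (I.biUnion E).powerset.filter (fun S => ∀ i ∈ I, (S ∩ E i).Nonempty), x ^ S.card =
      ∏ i ∈ I, ((x + 1) ^ (E i).card - 1) := by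
  induction I using Finset.induction_on with
  | empty => simp
  | insert i I hi ih =>
    rw [coe_insert] at hE
    have hd : Disjoint (E i) (I.biUnion E) := by
      refine (disjoint_biUnion_right _ _ _).2 fun j hj => ?_
      exact hE (Set.mem_insert _ _) (Set.mem_insert_of_mem _ hj) (fun h => hi (h ▸ hj))
    rw [prod_insert hi, ← ih (hE.subset (Set.subset_insert _ _)),
      ← sum_pow_card_powerset_nonempty, sum_mul_sum, ← sum_product']
    refine sum_nbij' (fun S => (S ∩ E i, S \ E i)) (fun T => T.1 ∪ T.2) ?_ ?_ ?_ ?_ ?_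
    · intro S hS
      simp only [mem_filter, mem_powerset, biUnion_insert, mem_product, mem_insert,
        forall_eq_or_imp] at hS ⊢
      refine ⟨⟨inter_subset_right, hS.2.1⟩, sdiff_le_iff.2 hS.1, fun j hj => ?_⟩
      obtain ⟨e, he⟩ := hS.2.2 j hj
      rw [mem_inter] at he
      refine ⟨e, mem_inter.2 ⟨mem_sdiff.2 ⟨he.1, fun hei => ?_⟩, he.2⟩⟩
      exact disjoint_left.1 hd hei (mem_biUnion.2 ⟨j, hj, he.2⟩)
    · rintro ⟨T, U⟩ h
      simp only [mem_filter, mem_powerset, biUnion_insert, mem_product, mem_insert,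
        forall_eq_or_imp] at h ⊢
      obtain ⟨⟨hT, e, he⟩, hU, hne⟩ := h
      refine ⟨union_subset_union hT hU, ⟨e, by simp [he, hT he]⟩, fun j hj => ?_⟩
      exact (hne j hj).mono (inter_subset_inter_right subset_union_right)
    · intro S _
      exact sup_inf_sdiff S (E i)
    · rintro ⟨T, U⟩ h
      simp only [mem_filter, mem_powerset, mem_product] at h
      have hU : Disjoint U (E i) := (hd.mono_right h.2.1).symm
      simp [union_inter_distrib_right, inter_eq_left.2 h.1.1, disjoint_iff_inter_eq_empty.1 hU,
        union_sdiff_distrib, sdiff_eq_empty_iff_subset.2 h.1.1, sdiff_eq_self_of_disjoint hU]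
    · intro S _
      rw [← pow_add, card_inter_add_card_sdiff]

theorem sub_one_mul_nq {R : Type*} [CommRing R] (q : R) (m : ℕ) :
    (q - 1) * nq q m = q ^ m - 1 :=
  mul_geom_sum q m

/-- **Increasing-tree formula** (from the proof of Theorem 6.2): for the multigraph with
`e_{i,j} = a_{max(i,j)}`,
`Σ_{S connected} (q-1)^{#S} = (q-1)^{#V-1} Σ_{T increasing} Π_{i ≠ root} [Σ_{j ∈ desc_T(i)∪{i}} a_j]_q`,
the sum running over increasing spanning trees rooted at `0` (encoded by parent maps `p`
with `p w < w` for `w ≠ 0`). -/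
theorem stmt15 (n : ℕ) (a : Fin (n+1) → ℕ) (ha : ∀ j, j ≠ 0 → 1 ≤ a j) :
    ∑ S ∈ (univ : Finset (a15Edges n a)).powerset.filter
        (fun S => SConnected (a15ends n a) S),
        ((Polynomial.X : Polynomial ℤ) - 1) ^ S.card =
      ((Polynomial.X : Polynomial ℤ) - 1) ^ n *
        ∑ p ∈ (univ : Finset (Fin (n+1) → Fin (n+1))).filter
            (fun p => p 0 = 0 ∧ ∀ w, w ≠ 0 → p w < w),
          ∏ w ∈ (univ : Finset (Fin (n+1))).erase 0,
            nq (Polynomial.X : Polynomial ℤ)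
              (∑ u ∈ univ.filter (fun u => ∃ k, p^[k] u = w), a u) := by
  have hfiber : (univ : Finset (a15Edges n a)).powerset.filter
        (fun S => SConnected (a15ends n a) S) =
      ((univ : Finset (Fin (n+1) → Fin (n+1))).filter
        (fun p => p 0 = 0 ∧ ∀ w, w ≠ 0 → p w < w)).biUnion
        (fun p => univ.filter fun S => Adapted p S) := by
    ext S
    simp only [powerset_univ, mem_filter, mem_univ, true_and, mem_biUnion]
    exact ⟨exists_adapted, fun ⟨_, hp, h⟩ => h.sConnected hp⟩
  rw [hfiber, sum_biUnion, mul_sum]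
  · refine sum_congr rfl fun p hp => ?_
    replace hp : IsIncreasing p := (mem_filter.1 hp).2
    have hpow : ((Polynomial.X : Polynomial ℤ) - 1) ^ n =
        ∏ _w ∈ univ.erase (0 : Fin (n+1)), (Polynomial.X - 1) := by simp
    refine (sum_congr ?_ fun _ _ => rfl).trans ((sum_pow_card_powerset_biUnion _ _ _
      (pairwiseDisjoint_subtreeEdges hp)).trans ?_)
    · ext S
      simp only [mem_filter, mem_univ, true_and, mem_powerset]
      exact adapted_iff hp
    rw [hpow, ← prod_mul_distrib]
    refine prod_congr rfl fun w hw => ?_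
    rw [sub_one_mul_nq, sub_add_cancel, card_subtreeEdges hp (ne_of_mem_erase hw)]
  · intro p hp p' hp' hne
    refine disjoint_left.2 fun S h h' => hne ?_
    exact Adapted.unique (mem_filter.1 hp).2 (mem_filter.1 hp').2 (mem_filter.1 h).2
      (mem_filter.1 h').2


end
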